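/- arXiv:2001.10917 — 4 statements merged into one kernel-verified Lean document; each statement's English description precedes it below -/
import Mathlib

section
/- Let φ denote the density of the standard d-dimensional normal distribution. Fix a constant K ≥ 0 and an integer r ≥ 1, and for each d ≥ 3 set η = K/√(log d). Then there is a constant C_{K,r} > 0 depending only on K and r such that for all d ≥ 3: sup_{A∈𝓡} ∑_{j_1,…,j_r=1}^d sup_{y : ‖y‖_∞ ≤ η} |∫_A ∂_{j_1 ⋯ j_r} φ(z + y) dz| ≤ C_{K,r} (log d)^{r/2}. -/
open MeasureTheory Real

noncomputable section

/-- Density of the standard `d`-dimensional normal distribution. -/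
def stdGaussianPdf (d : ℕ) (x : Fin d → ℝ) : ℝ :=
  (2 * π) ^ (-(d : ℝ) / 2) * Real.exp (-(∑ j, x j ^ 2) / 2)

/-- `A` is a hyperrectangle `∏ (a_j, b_j)` with `-∞ ≤ a_j ≤ b_j ≤ ∞`. -/
def IsHyperrectangle {d : ℕ} (A : Set (Fin d → ℝ)) : Prop :=
  ∃ a b : Fin d → EReal, A = {x | ∀ j, a j < (x j : EReal) ∧ (x j : EReal) < b j}

/-- Iterated partial derivative `∂_{j_1 ⋯ j_r} f` along a list of coordinates. -/
def pdSeq {d : ℕ} : List (Fin d) → ((Fin d → ℝ) → ℝ) → ((Fin d → ℝ) → ℝ)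
  | [], f => f
  | j :: js, f => pdSeq js fun x => fderiv ℝ f x (Pi.single j 1)


/-! ### One-dimensional Gaussian derivatives -/

/-- Polynomials with `φ^{(n)} = p_n φ`. -/
def gpoly : ℕ → Polynomial ℝ
  | 0 => 1
  | n + 1 => Polynomial.derivative (gpoly n) - Polynomial.X * gpoly n

/-- One-dimensional density. -/
def gphi (x : ℝ) : ℝ := (2 * π) ^ (-(1 : ℝ) / 2) * Real.exp (-(x ^ 2) / 2)

/-- Derivatives of the density. -/
def gpsi (n : ℕ) (x : ℝ) : ℝ := (gpoly n).eval x * gphi x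

theorem gpsi_zero (x : ℝ) : gpsi 0 x = gphi x := by simp [gpsi, gpoly]

theorem gphi_pos (x : ℝ) : 0 < gphi x := by unfold gphi; positivity

theorem gphi_hasDerivAt (x : ℝ) : HasDerivAt gphi (-x * gphi x) x := by
  have h : HasDerivAt (fun x : ℝ => -(x ^ 2) / 2) (-x) x := by
    have := ((hasDerivAt_id x).pow 2).neg.div_const 2
    exact this.congr_deriv (by simp; ring)
  have := h.exp.const_mul ((2 * π) ^ (-(1 : ℝ) / 2))
  exact this.congr_deriv (by unfold gphi; ring)

theorem gpsi_hasDerivAt (n : ℕ) (x : ℝ) : HasDerivAt (gpsi n) (gpsi (n + 1) x) x := by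
  have := ((gpoly n).hasDerivAt x).mul (gphi_hasDerivAt x)
  exact this.congr_deriv (by simp [gpsi, gpoly]; ring)

theorem gpsi_continuous (n : ℕ) : Continuous (gpsi n) :=
  continuous_iff_continuousAt.2 fun x => (gpsi_hasDerivAt n x).continuousAt

theorem gpoly_natDegree (n : ℕ) : (gpoly n).natDegree ≤ n := by
  induction n with
  | zero => simp [gpoly]
  | succ n ih =>
    simp only [gpoly]
    refine (Polynomial.natDegree_sub_le _ _).trans (max_le ?_ ?_)
    · exact (Polynomial.natDegree_derivative_le _).trans (by omega)
    · refine (Polynomial.natDegree_mul_le).trans ?_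
      simp
      omega

theorem gpoly_bound (n : ℕ) :
    ∃ B : ℝ, 0 ≤ B ∧ ∀ x : ℝ, |(gpoly n).eval x| ≤ B * (1 + |x|) ^ n := by
  refine ⟨∑ i ∈ Finset.range (n + 1), |(gpoly n).coeff i|, by positivity, fun x => ?_⟩
  rw [Polynomial.eval_eq_sum_range' (Nat.lt_succ_of_le (gpoly_natDegree n)), Finset.sum_mul]
  refine (Finset.abs_sum_le_sum_abs _ _).trans (Finset.sum_le_sum fun i hi => ?_)
  rw [abs_mul, abs_pow]
  have hi' : i ≤ n := by simpa [Nat.lt_succ_iff] using hi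
  refine mul_le_mul_of_nonneg_left ?_ (abs_nonneg _)
  calc |x| ^ i ≤ (1 + |x|) ^ i := by gcongr; linarith
    _ ≤ (1 + |x|) ^ n := pow_le_pow_right₀ (by linarith [abs_nonneg x]) hi'

theorem gpsi_bound (n : ℕ) :
    ∃ B : ℝ, 0 ≤ B ∧ (∀ x : ℝ, |gpsi n x| ≤ B * (1 + |x|) ^ n * gphi x) ∧
      ∀ x : ℝ, |gpsi n x| ≤ B * Real.exp (-(1 / 4) * x ^ 2) := by
  obtain ⟨B, hB, h⟩ := gpoly_bound n
  have h1 : ∀ x : ℝ, |gpsi n x| ≤ B * (1 + |x|) ^ n * gphi x := by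
    intro x
    rw [gpsi, abs_mul, abs_of_pos (gphi_pos x)]
    exact mul_le_mul_of_nonneg_right (h x) (gphi_pos x).le
  set c : ℝ := (2 * π) ^ (-(1 : ℝ) / 2) with hc
  have hc0 : 0 < c := by positivity
  refine ⟨B + B * n.factorial * Real.exp 2 * c, by positivity, fun x => (h1 x).trans ?_,
    fun x => (h1 x).trans ?_⟩
  · have := (gphi_pos x).le
    gcongr
    have : 0 ≤ B * n.factorial * Real.exp 2 * c := by positivity
    linarith
  · have h2 : (1 + |x|) ^ n ≤ n.factorial * Real.exp (1 + |x|) := by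
      have := Real.pow_div_factorial_le_exp (1 + |x|) (by positivity) n
      rwa [div_le_iff₀ (by positivity), mul_comm] at this
    have h3 : Real.exp (1 + |x|) ≤ Real.exp 2 * Real.exp (1 / 4 * x ^ 2) := by
      rw [← Real.exp_add]
      apply Real.exp_le_exp.2
      nlinarith [sq_nonneg (|x| - 2), sq_abs x]
    have h4 : gphi x = c * (Real.exp (-(1 / 4) * x ^ 2) * Real.exp (-(1 / 4) * x ^ 2)) := by
      rw [gphi, ← Real.exp_add]; congr 2; ring
    have h5 : Real.exp (1 / 4 * x ^ 2) * Real.exp (-(1 / 4) * x ^ 2) = 1 := by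
      rw [← Real.exp_add]; simp
    calc B * (1 + |x|) ^ n * gphi x
        ≤ B * (n.factorial * (Real.exp 2 * Real.exp (1 / 4 * x ^ 2))) * gphi x := by
          have := (gphi_pos x).le
          gcongr
          exact h2.trans (by gcongr)
      _ = B * n.factorial * Real.exp 2 * c * Real.exp (-(1 / 4) * x ^ 2) *
          (Real.exp (1 / 4 * x ^ 2) * Real.exp (-(1 / 4) * x ^ 2)) := by rw [h4]; ring
      _ ≤ _ := by
          rw [h5, mul_one]
          gcongr
          linarith

theorem gpsi_integrable (n : ℕ) : Integrable (gpsi n) := by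
  obtain ⟨B, hB, -, h⟩ := gpsi_bound n
  refine Integrable.mono' ((integrable_exp_neg_mul_sq (b := 1 / 4) (by norm_num)).const_mul B)
    (gpsi_continuous n).aestronglyMeasurable (Filter.Eventually.of_forall fun x => ?_)
  simpa using h x

theorem gphi_integrable : Integrable gphi := by
  have := gpsi_integrable 0
  have h : gpsi 0 = gphi := funext gpsi_zero
  rwa [h] at this

theorem gphi_integral : ∫ x, gphi x = 1 := by
  unfold gphi
  rw [integral_const_mul]
  have : ∀ x : ℝ, Real.exp (-(x ^ 2) / 2) = Real.exp (-(1 / 2) * x ^ 2) := by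
    intro x; congr 1; ring
  simp_rw [this]
  rw [integral_gaussian, Real.sqrt_eq_rpow, div_div_eq_mul_div, div_one, mul_comm π 2]
  rw [← Real.rpow_add (by positivity)]
  norm_num

theorem gpsi_tendsto (n : ℕ) :
    Filter.Tendsto (gpsi n) Filter.atTop (nhds 0) ∧
      Filter.Tendsto (gpsi n) Filter.atBot (nhds 0) := by
  constructor
  · exact tendsto_zero_of_hasDerivAt_of_integrableOn_Ioi (a := 0)
      (fun x _ => gpsi_hasDerivAt n x) (gpsi_integrable (n + 1)).integrableOn
      (gpsi_integrable n).integrableOn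
  · exact tendsto_zero_of_hasDerivAt_of_integrableOn_Iic (a := 0)
      (fun x _ => gpsi_hasDerivAt n x) (gpsi_integrable (n + 1)).integrableOn
      (gpsi_integrable n).integrableOn

/-- Pointwise bound of a derivative by the Gaussian mass of a nearby short interval. -/
theorem gpsi_point_bound (K : ℝ) (hK : 0 ≤ K) (n : ℕ) :
    ∃ C : ℝ, 0 ≤ C ∧ ∀ s : ℝ, 1 ≤ s → ∀ x c : ℝ, |c - x| ≤ (2 * K + 1) / s →
      |gpsi n x| ≤ C * s ^ (n + 1) * ((∫ z in c..(c + 1 / s), gphi z) + Real.exp (-s ^ 2)) := by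
  obtain ⟨B, hB, h1, h2⟩ := gpsi_bound n
  set M := 2 * K + 2 with hM
  set D := (4 * M + M ^ 2) / 2 with hD
  refine ⟨B * 3 ^ n * Real.exp D + B, by positivity, fun s hs x c hcx => ?_⟩
  have hs0 : 0 < s := by linarith
  have hint0 : 0 ≤ ∫ z in c..(c + 1 / s), gphi z :=
    intervalIntegral.integral_nonneg (by simp; positivity) fun z _ => (gphi_pos z).le
  have hsn : 1 ≤ s ^ (n + 1) := one_le_pow₀ hs
  by_cases hx : |x| ≤ 2 * s
  · have hv : ∀ v ∈ Set.Icc c (c + 1 / s), Real.exp (-D) * gphi x ≤ gphi v := by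
      intro v hv
      have hvx : |v - x| ≤ M / s := by
        have e1 : M / s = (2 * K + 1) / s + 1 / s := by rw [hM]; ring
        rw [e1]
        have := abs_le.1 hcx
        have hp : 0 < 1 / s := by positivity
        rw [abs_le]
        constructor <;> linarith [hv.1, hv.2]
      have hMs : M / s ≤ M := div_le_self (by positivity) hs
      have e2 : |x| * |v - x| ≤ 2 * M := by
        calc |x| * |v - x| ≤ (2 * s) * (M / s) := by gcongr
          _ = 2 * M := by field_simp
      have e3 : (v - x) ^ 2 ≤ M ^ 2 := by
        rw [← sq_abs (v - x)]
        exact pow_le_pow_left₀ (abs_nonneg _) (hvx.trans hMs) 2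
      have e4 : x * (v - x) ≤ 2 * M := (le_abs_self _).trans (by rw [abs_mul]; exact e2)
      unfold gphi
      rw [mul_left_comm, ← Real.exp_add]
      gcongr
      rw [hD]
      nlinarith
    have hlow : 1 / s * (Real.exp (-D) * gphi x) ≤ ∫ z in c..(c + 1 / s), gphi z := by
      have := intervalIntegral.integral_mono_on (μ := volume) (a := c) (b := c + 1 / s)
        (f := fun _ => Real.exp (-D) * gphi x) (g := gphi) (by simp; positivity)
        (by simp) gphi_integrable.intervalIntegrable hv
      rw [intervalIntegral.integral_const, smul_eq_mul, add_sub_cancel_left] at this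
      exact this
    have hphi : gphi x ≤ Real.exp D * s * ∫ z in c..(c + 1 / s), gphi z := by
      calc gphi x = Real.exp D * s * (1 / s * (Real.exp (-D) * gphi x)) := by
            rw [Real.exp_neg]; field_simp
        _ ≤ _ := by gcongr
    have hp := gphi_pos x
    calc |gpsi n x| ≤ B * (1 + |x|) ^ n * gphi x := h1 x
      _ ≤ B * (3 * s) ^ n * (Real.exp D * s * ∫ z in c..(c + 1 / s), gphi z) := by
          gcongr
          linarith
      _ = B * 3 ^ n * Real.exp D * s ^ (n + 1) * ((∫ z in c..(c + 1 / s), gphi z) + 0) := by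
          rw [mul_pow]; ring
      _ ≤ _ := by
          gcongr
          · linarith
          · positivity
  · push Not at hx
    have : 4 * s ^ 2 ≤ x ^ 2 := by
      rw [← sq_abs x]; nlinarith
    calc |gpsi n x| ≤ B * Real.exp (-(1 / 4) * x ^ 2) := h2 x
      _ ≤ B * 1 * (0 + Real.exp (-s ^ 2)) := by
          rw [zero_add, mul_one]; gcongr; linarith
      _ ≤ _ := by
          gcongr
          have : 0 ≤ B * 3 ^ n * Real.exp D := by positivity
          linarith

/-! ### Intervals -/

/-- Interval with extended real endpoints. -/
def eI (a b : EReal) : Set ℝ := {x | a < (x : EReal) ∧ (x : EReal) < b}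

theorem eI_measurable (a b : EReal) : MeasurableSet (eI a b) := by
  have h1 : Measurable (fun x : ℝ => (x : EReal)) := measurable_coe_real_ereal
  exact (measurableSet_lt measurable_const h1).inter (measurableSet_lt h1 measurable_const)

theorem gphi_strip (S : Set ℝ) (hS : MeasurableSet S) (t c h : ℝ) (hh : 0 ≤ h)
    (hd : Disjoint S (Set.Ioo c (c + h))) :
    ∫ z in (c + t)..(c + t + h), gphi z ≤ 1 - ∫ z in S, gphi (z + t) := by
  have hi : Integrable (fun z => gphi (z + t)) := gphi_integrable.comp_add_right t
  have h1 : ∫ z in (c + t)..(c + t + h), gphi z = ∫ z in Set.Ioo c (c + h), gphi (z + t) := by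
    rw [← integral_Ioc_eq_integral_Ioo, ← intervalIntegral.integral_of_le (by linarith),
      intervalIntegral.integral_comp_add_right]
    congr 1; ring
  have h2 : ∫ z, gphi (z + t) = 1 := by
    rw [integral_add_right_eq_self (μ := volume) gphi t, gphi_integral]
  have h3 := setIntegral_union hd measurableSet_Ioo hi.integrableOn hi.integrableOn
  have h4 := setIntegral_le_integral (s := S ∪ Set.Ioo c (c + h)) hi
    (Filter.Eventually.of_forall fun z => (gphi_pos (z + t)).le)
  rw [h1]
  linarith

theorem gpsi_endpoint (K : ℝ) (hK : 0 ≤ K) (n : ℕ) :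
    ∃ C : ℝ, 0 ≤ C ∧ ∀ s : ℝ, 1 ≤ s → ∀ t t' : ℝ, |t| ≤ K / s → |t'| ≤ K / s →
      ∀ (b : ℝ) (S : Set ℝ), MeasurableSet S →
      (Disjoint S (Set.Ioo b (b + 1 / s)) ∨ Disjoint S (Set.Ioo (b - 1 / s) b)) →
      |gpsi n (b + t')| ≤
        C * s ^ (n + 1) * ((1 - ∫ z in S, gphi (z + t)) + Real.exp (-s ^ 2)) := by
  obtain ⟨C, hC, h⟩ := gpsi_point_bound K hK n
  refine ⟨C, hC, fun s hs t t' ht ht' b S hS hd => ?_⟩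
  have hp : 0 < 1 / s := by positivity
  have hs0 : 0 < s := by linarith
  have e : (2 * K + 1) / s = K / s + K / s + 1 / s := by ring
  rw [abs_le] at ht ht'
  rcases hd with hd | hd
  · refine (h s hs (b + t') (b + t) ?_).trans ?_
    · rw [e, abs_le]; constructor <;> linarith
    · gcongr
      exact gphi_strip S hS t b (1 / s) hp.le hd
  · refine (h s hs (b + t') (b - 1 / s + t) ?_).trans ?_
    · rw [e, abs_le]; constructor <;> linarith
    · gcongr
      refine gphi_strip S hS t (b - 1 / s) (1 / s) hp.le ?_
      rwa [sub_add_cancel]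

theorem gpsi_ftc (n : ℕ) (a b : EReal) (t F : ℝ) (hF : 0 ≤ F)
    (h : ∀ x : ℝ, (x : EReal) = a ∨ (x : EReal) = b → |gpsi n (x + t)| ≤ F) :
    |∫ z in eI a b, gpsi (n + 1) (z + t)| ≤ 2 * F := by
  have hd : ∀ x : ℝ, HasDerivAt (fun z => gpsi n (z + t)) (gpsi (n + 1) (x + t)) x :=
    fun x => (gpsi_hasDerivAt n (x + t)).comp_add_const x t
  have hi : Integrable (fun z => gpsi (n + 1) (z + t)) := (gpsi_integrable (n + 1)).comp_add_right t
  have hi0 : Integrable (fun z => gpsi n (z + t)) := (gpsi_integrable n).comp_add_right t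
  have htop : Filter.Tendsto (fun z => gpsi n (z + t)) Filter.atTop (nhds 0) :=
    (gpsi_tendsto n).1.comp (Filter.tendsto_atTop_add_const_right _ t Filter.tendsto_id)
  have hbot : Filter.Tendsto (fun z => gpsi n (z + t)) Filter.atBot (nhds 0) :=
    (gpsi_tendsto n).2.comp (Filter.tendsto_atBot_add_const_right _ t Filter.tendsto_id)
  induction a with
  | top =>
    have : eI ⊤ b = ∅ := by ext x; simp [eI]
    simp [this, hF]
  | bot =>
    induction b with
    | bot =>
      have : eI ⊥ ⊥ = ∅ := by ext x; simp [eI]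
      simp [this, hF]
    | top =>
      have : eI ⊥ ⊤ = Set.univ := by ext x; simp [eI]
      rw [this, setIntegral_univ, integral_eq_zero_of_hasDerivAt_of_integrable hd hi hi0]
      simp [hF]
    | coe b =>
      have : eI ⊥ b = Set.Iio b := by ext x; simp [eI]
      rw [this, ← integral_Iic_eq_integral_Iio,
        integral_Iic_of_hasDerivAt_of_tendsto' (fun x _ => hd x) hi.integrableOn hbot]
      have := h b (Or.inr rfl)
      rw [sub_zero]; linarith
  | coe a =>
    induction b with
    | bot =>
      have : eI a ⊥ = ∅ := by ext x; simp [eI]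
      simp [this, hF]
    | top =>
      have : eI a ⊤ = Set.Ioi a := by ext x; simp [eI]
      rw [this, integral_Ioi_of_hasDerivAt_of_tendsto' (fun x _ => hd x) hi.integrableOn htop]
      have := h a (Or.inl rfl)
      rw [zero_sub, abs_neg]; linarith
    | coe b =>
      have : eI a b = Set.Ioo a b := by ext x; simp [eI]
      rw [this]
      rcases le_total b a with hab | hab
      · simp [Set.Ioo_eq_empty_of_le hab, hF]
      · rw [← integral_Ioc_eq_integral_Ioo, ← intervalIntegral.integral_of_le hab,
          intervalIntegral.integral_eq_sub_of_hasDerivAt (fun x _ => hd x) hi.intervalIntegrable]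
        have h1 := h a (Or.inl rfl)
        have h2 := h b (Or.inr rfl)
        have := abs_sub (gpsi n (b + t)) (gpsi n (a + t))
        linarith

theorem gphi_eI_bounds (S : Set ℝ) (t : ℝ) :
    0 ≤ ∫ z in S, gphi (z + t) ∧ ∫ z in S, gphi (z + t) ≤ 1 := by
  have hi : Integrable (fun z => gphi (z + t)) := gphi_integrable.comp_add_right t
  have h2 : ∫ z, gphi (z + t) = 1 := by
    rw [integral_add_right_eq_self (μ := volume) gphi t, gphi_integral]
  refine ⟨integral_nonneg fun z => (gphi_pos _).le, ?_⟩
  rw [← h2]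
  exact setIntegral_le_integral hi (Filter.Eventually.of_forall fun z => (gphi_pos (z + t)).le)

theorem gpsi_interval (K : ℝ) (hK : 0 ≤ K) (n : ℕ) :
    ∃ C : ℝ, 0 ≤ C ∧ ∀ s : ℝ, 1 ≤ s → ∀ t t' : ℝ, |t| ≤ K / s → |t'| ≤ K / s →
      ∀ a b : EReal, |∫ z in eI a b, gpsi (n + 1) (z + t')| ≤
        C * s ^ (n + 1) * ((1 - ∫ z in eI a b, gphi (z + t)) + Real.exp (-s ^ 2)) := by
  obtain ⟨C, hC, h⟩ := gpsi_endpoint K hK n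
  refine ⟨2 * C, by positivity, fun s hs t t' ht ht' a b => ?_⟩
  have hP := (gphi_eI_bounds (eI a b) t).2
  refine (gpsi_ftc n a b t' (C * s ^ (n + 1) *
    ((1 - ∫ z in eI a b, gphi (z + t)) + Real.exp (-s ^ 2))) ?_ ?_).trans (le_of_eq (by ring))
  · have : 0 ≤ (1 - ∫ z in eI a b, gphi (z + t)) := by linarith
    positivity
  · intro x hx
    refine h s hs t t' ht ht' x _ (eI_measurable a b) ?_
    rcases hx with rfl | rfl
    · right
      rw [Set.disjoint_left]
      intro z hz hz'
      have := hz.1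
      rw [EReal.coe_lt_coe_iff] at this
      exact absurd hz'.2 (not_lt.2 this.le)
    · left
      rw [Set.disjoint_left]
      intro z hz hz'
      have := hz.2
      rw [EReal.coe_lt_coe_iff] at this
      exact absurd hz'.1 (not_lt.2 this.le)

/-- Main one-dimensional lemma. -/
theorem one_dim (K : ℝ) (hK : 0 ≤ K) (r : ℕ) :
    ∃ C : ℝ, 1 ≤ C ∧ ∀ s : ℝ, 1 ≤ s → ∀ a b : EReal, ∃ ε : ℝ, 0 ≤ ε ∧ ε ≤ 1 ∧
      ∀ t : ℝ, |t| ≤ K / s →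
        |∫ z in eI a b, gpsi 0 (z + t)| ≤ 1 - ε ∧
        ∀ m, 1 ≤ m → m ≤ r →
          |∫ z in eI a b, gpsi m (z + t)| ≤ (C * s) ^ m * (ε + Real.exp (-s ^ 2)) := by
  choose C hC h using fun n => gpsi_interval K hK n
  have hsum : 0 ≤ ∑ n ∈ Finset.range r, C n := Finset.sum_nonneg fun n _ => hC n
  refine ⟨1 + ∑ n ∈ Finset.range r, C n, by linarith, fun s hs a b => ?_⟩
  have hs0 : 0 < s := by linarith
  have : Nonempty {t : ℝ // |t| ≤ K / s} := ⟨⟨0, by simp; positivity⟩⟩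
  set g : {t : ℝ // |t| ≤ K / s} → ℝ := fun t => 1 - ∫ z in eI a b, gphi (z + t.1) with hg
  have hg0 : ∀ t, 0 ≤ g t := fun t => by
    have := (gphi_eI_bounds (eI a b) t.1).2
    simp only [hg]; linarith
  have hg1 : ∀ t, g t ≤ 1 := fun t => by
    have := (gphi_eI_bounds (eI a b) t.1).1
    simp only [hg]; linarith
  have hbdd : BddBelow (Set.range g) := ⟨0, by rintro _ ⟨t, rfl⟩; exact hg0 t⟩
  refine ⟨⨅ t, g t, le_ciInf hg0, ?_, ?_⟩
  · obtain ⟨t⟩ := this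
    exact (ciInf_le hbdd t).trans (hg1 t)
  · intro t ht
    constructor
    · have h1 := ciInf_le hbdd ⟨t, ht⟩
      simp_rw [gpsi_zero]
      rw [abs_of_nonneg (gphi_eI_bounds (eI a b) t).1]
      simp only [hg] at h1 ⊢
      linarith
    · intro m hm hmr
      obtain ⟨n, rfl⟩ : ∃ n, m = n + 1 := ⟨m - 1, by omega⟩
      have hCn : C n ≤ ∑ n ∈ Finset.range r, C n :=
        Finset.single_le_sum (f := C) (fun i _ => hC i) (Finset.mem_range.2 (by omega))
      set X := 1 + ∑ n ∈ Finset.range r, C n with hX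
      have hX1 : 1 ≤ X := by linarith
      have hXn : C n ≤ X ^ (n + 1) := (by linarith : C n ≤ X).trans (le_self_pow₀ hX1 (by omega))
      have hpos : 0 < (X * s) ^ (n + 1) := by positivity
      rw [← div_le_iff₀' hpos, ← sub_le_iff_le_add]
      refine le_ciInf fun t₀ => ?_
      rw [sub_le_iff_le_add, div_le_iff₀' hpos]
      refine (h n s hs t₀.1 t t₀.2 ht a b).trans ?_
      have := hg0 t₀
      change C n * s ^ (n + 1) * (g t₀ + _) ≤ _
      rw [mul_pow]
      gcongr

/-! ### Combinatorics -/

theorem sum_support_prod (d : ℕ) (w : Fin d → ℝ) (hw : ∀ j, 0 ≤ w j) (r : ℕ) :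
    ∑ J : Fin r → Fin d, ∏ j, (if ∃ i, J i = j then w j else 1) ≤ (r + ∑ j, w j) ^ r := by
  have hS : 0 ≤ ∑ j, w j := Finset.sum_nonneg fun j _ => hw j
  induction r with
  | zero => simp
  | succ r ih =>
    rw [← (Fin.consEquiv (fun _ : Fin (r + 1) => Fin d)).sum_comp, Fintype.sum_prod_type,
      Finset.sum_comm]
    set G : (Fin r → Fin d) → ℝ := fun J => ∏ j, (if ∃ i, J i = j then w j else 1) with hG
    have hG0 : ∀ J, 0 ≤ G J := fun J => Finset.prod_nonneg fun j _ => by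
      split_ifs
      exacts [hw j, zero_le_one]
    have key : ∀ (J : Fin r → Fin d) (k : Fin d),
        ∏ j, (if ∃ i, (Fin.consEquiv (fun _ : Fin (r + 1) => Fin d)) (k, J) i = j then w j else 1)
          ≤ ((if ∃ i, J i = k then 1 else 0) + w k) * G J := by
      intro J k
      have e : ∀ j, (∃ i, (Fin.consEquiv (fun _ : Fin (r + 1) => Fin d)) (k, J) i = j) ↔
          (k = j ∨ ∃ i, J i = j) := by
        intro j
        simp [Fin.consEquiv, Fin.exists_fin_succ]
      simp_rw [e]
      by_cases hk : ∃ i, J i = k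
      · have : ∀ j, (k = j ∨ ∃ i, J i = j) ↔ ∃ i, J i = j := by
          intro j
          constructor
          · rintro (rfl | h)
            exacts [hk, h]
          · exact Or.inr
        simp_rw [this]
        rw [if_pos hk]
        have := mul_nonneg (hw k) (hG0 J)
        change G J ≤ _
        linarith
      · rw [if_neg hk, zero_add]
        simp only [hG]
        rw [← Finset.mul_prod_erase _ _ (Finset.mem_univ k),
          ← Finset.mul_prod_erase _ _ (Finset.mem_univ k)]
        simp only [true_or, if_true, if_neg hk, one_mul]
        refine le_of_eq ?_
        congr 1
        refine Finset.prod_congr rfl fun j hj => ?_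
        have : k ≠ j := (Finset.ne_of_mem_erase hj).symm
        simp [this]
    have hcount : ∀ J : Fin r → Fin d, ∑ k, (if ∃ i, J i = k then (1 : ℝ) else 0) ≤ r := by
      intro J
      rw [Finset.sum_boole]
      have : (Finset.univ.filter fun k => ∃ i, J i = k) = Finset.univ.image J := by
        ext; simp
      rw [this]
      exact_mod_cast Finset.card_image_le.trans (by simp)
    calc _ ≤ ∑ J : Fin r → Fin d, ∑ k, ((if ∃ i, J i = k then 1 else 0) + w k) * G J :=
          Finset.sum_le_sum fun J _ => Finset.sum_le_sum fun k _ => key J k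
      _ = ∑ J : Fin r → Fin d, ((∑ k, if ∃ i, J i = k then 1 else 0) + ∑ k, w k) * G J := by
          refine Finset.sum_congr rfl fun J _ => ?_
          rw [← Finset.sum_mul, Finset.sum_add_distrib]
      _ ≤ ∑ J : Fin r → Fin d, (r + ∑ k, w k) * G J :=
          Finset.sum_le_sum fun J _ => mul_le_mul_of_nonneg_right
            (by linarith [hcount J]) (hG0 J)
      _ = (r + ∑ k, w k) * ∑ J, G J := by rw [Finset.mul_sum]
      _ ≤ (r + ∑ k, w k) * (r + ∑ k, w k) ^ r := by gcongr
      _ = (r + ∑ k, w k) ^ (r + 1) := by ring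
      _ ≤ _ := by
          gcongr
          simp

/-! ### Several variables -/

theorem stdGaussianPdf_eq (d : ℕ) :
    stdGaussianPdf d = fun x => ∏ j, gpsi 0 (x j) := by
  funext x
  simp_rw [gpsi_zero]
  unfold gphi stdGaussianPdf
  rw [Finset.prod_mul_distrib, ← Real.exp_sum, Finset.prod_const, ← Real.rpow_natCast,
    ← Real.rpow_mul (by positivity)]
  congr 2
  · simp; ring
  · rw [← Finset.sum_div, Finset.sum_neg_distrib]

theorem pdSeq_prod (d : ℕ) (js : List (Fin d)) (k : Fin d → ℕ) :
    pdSeq js (fun x : Fin d → ℝ => ∏ j, gpsi (k j) (x j)) =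
      fun x => ∏ j, gpsi (k j + js.count j) (x j) := by
  induction js generalizing k with
  | nil => simp [pdSeq]
  | cons i js ih =>
    rw [pdSeq]
    have : (fun x : Fin d → ℝ => fderiv ℝ (fun x : Fin d → ℝ => ∏ j, gpsi (k j) (x j)) x
        (Pi.single i 1)) = fun x => ∏ j, gpsi ((k + Pi.single i 1 : Fin d → ℕ) j) (x j) := by
      funext x
      have h1 : ∀ j ∈ Finset.univ, HasFDerivAt (fun x : Fin d → ℝ => gpsi (k j) (x j))
          (gpsi (k j + 1) (x j) • (ContinuousLinearMap.proj j : (Fin d → ℝ) →L[ℝ] ℝ)) x := by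
        intro j _
        have hp : HasFDerivAt (fun f : Fin d → ℝ => f j)
          (ContinuousLinearMap.proj j : (Fin d → ℝ) →L[ℝ] ℝ) x := hasFDerivAt_apply j x
        exact HasDerivAt.comp_hasFDerivAt (f := fun f : Fin d → ℝ => f j) x
          (gpsi_hasDerivAt (k j) (x j)) hp
      rw [(HasFDerivAt.finsetProd h1).fderiv]
      simp only [sum_apply, smul_apply,
        ContinuousLinearMap.proj_apply, smul_eq_mul]
      rw [Finset.sum_eq_single i, ← Finset.mul_prod_erase _ _ (Finset.mem_univ i)]
      · simp only [Pi.single_eq_same, mul_one, Pi.add_apply]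
        rw [mul_comm]
        congr 1
        refine Finset.prod_congr rfl fun j hj => ?_
        rw [Pi.single_eq_of_ne (Finset.ne_of_mem_erase hj), add_zero]
      · intro j _ hj
        rw [Pi.single_eq_of_ne hj]; simp
      · simp
    rw [this, ih]
    funext x
    refine Finset.prod_congr rfl fun j _ => ?_
    congr 1
    rw [List.count_cons, Pi.add_apply]
    by_cases h : i = j
    · subst h; simp; ring
    · simp [h, Ne.symm h]

theorem integral_eq (d : ℕ) (a b : Fin d → EReal) (js : List (Fin d)) (y : Fin d → ℝ) :
    ∫ z in {x : Fin d → ℝ | ∀ j, a j < (x j : EReal) ∧ (x j : EReal) < b j},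
      pdSeq js (stdGaussianPdf d) (z + y) ∂volume =
      ∏ j, ∫ z in eI (a j) (b j), gpsi (js.count j) (z + y j) := by
  have hA : {x : Fin d → ℝ | ∀ j, a j < (x j : EReal) ∧ (x j : EReal) < b j} =
      Set.pi Set.univ fun j => eI (a j) (b j) := by
    ext x; simp [eI]
  rw [hA, stdGaussianPdf_eq, pdSeq_prod, volume_pi, Measure.restrict_pi_pi]
  simp only [zero_add, Pi.add_apply]
  exact integral_fintype_prod_eq_prod (fun j z => gpsi (js.count j) (z + y j))

theorem sum_sup_integral_deriv_gaussian_le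
    (K : ℝ) (hK : 0 ≤ K) (r : ℕ) (hr : 1 ≤ r) :
    ∃ C : ℝ, 0 < C ∧
      ∀ (d : ℕ), 3 ≤ d →
      ∀ A : Set (Fin d → ℝ), IsHyperrectangle A →
        ∑ J : Fin r → Fin d,
          ⨆ y : {y : Fin d → ℝ // ‖y‖ ≤ K / Real.sqrt (Real.log d)},
            |∫ z in A, pdSeq (List.ofFn J) (stdGaussianPdf d) (z + y.1) ∂volume| ≤
        C * (Real.log d) ^ ((r : ℝ) / 2) := by
  obtain ⟨C, hC, h⟩ := one_dim K hK r
  refine ⟨C ^ r * (Real.exp 1 ^ r * (r.factorial * Real.exp (r + 1))), by positivity, ?_⟩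
  rintro d hd A ⟨a, b, rfl⟩
  have hL : 1 ≤ Real.log d := by
    rw [Real.le_log_iff_exp_le (by positivity)]
    have : (3 : ℝ) ≤ d := by exact_mod_cast hd
    linarith [Real.exp_one_lt_d9]
  set s := Real.sqrt (Real.log d) with hs
  have hs1 : 1 ≤ s := by rw [hs]; exact Real.one_le_sqrt.2 hL
  have hs2 : s ^ 2 = Real.log d := Real.sq_sqrt (by linarith)
  have hexp : Real.exp (-s ^ 2) = 1 / d := by
    rw [hs2, Real.exp_neg, Real.exp_log (by positivity), one_div]
  choose ε hε0 hε1 hε using fun j => h s hs1 (a j) (b j)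
  rw [hexp] at hε
  set S := ∑ j, ε j with hSdef
  have hS : 0 ≤ S := Finset.sum_nonneg fun j _ => hε0 j
  set w : Fin d → ℝ := fun j => Real.exp 1 * (ε j + 1 / d) with hw
  have hw0 : ∀ j, 0 ≤ w j := fun j => by
    have := hε0 j
    simp only [hw]; positivity
  have hsumw : ∑ j, w j = Real.exp 1 * (S + 1) := by
    simp only [hw]
    rw [← Finset.mul_sum, Finset.sum_add_distrib]
    have : (d : ℝ) ≠ 0 := by positivity
    simp [this, hSdef]
  have hJ : ∀ J : Fin r → Fin d,
      (⨆ y : {y : Fin d → ℝ // ‖y‖ ≤ K / s},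
        |∫ z in {x : Fin d → ℝ | ∀ j, a j < (x j : EReal) ∧ (x j : EReal) < b j},
          pdSeq (List.ofFn J) (stdGaussianPdf d) (z + y.1) ∂volume|) ≤
      (C * s) ^ r * Real.exp (-S) * ∏ j, (if ∃ i, J i = j then w j else 1) := by
    intro J
    have hsplit : (C * s) ^ r * Real.exp (-S) * ∏ j, (if ∃ i, J i = j then w j else 1) =
        ∏ j, ((C * s) ^ ((List.ofFn J).count j) * Real.exp (-ε j) *
          (if ∃ i, J i = j then w j else 1)) := by
      rw [Finset.prod_mul_distrib, Finset.prod_mul_distrib, Finset.prod_pow_eq_pow_sum,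
        ← Real.exp_sum, Finset.sum_neg_distrib]
      congr 4
      have := Multiset.sum_count_eq_card (s := (Finset.univ : Finset (Fin d)))
        (m := (List.ofFn J : Multiset (Fin d))) (by simp)
      simpa using this.symm
    rw [hsplit]
    refine Real.iSup_le (fun y => ?_) (Finset.prod_nonneg fun j _ => ?_)
    · rw [integral_eq, Finset.abs_prod]
      refine Finset.prod_le_prod (fun j _ => abs_nonneg _) fun j _ => ?_
      have hy : |y.1 j| ≤ K / s := (norm_le_pi_norm y.1 j).trans y.2
      have hmem : (∃ i, J i = j) ↔ 0 < (List.ofFn J).count j := by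
        rw [List.count_pos_iff, List.mem_ofFn]
      by_cases hj : ∃ i, J i = j
      · rw [if_pos hj]
        have h1 := (hε j (y.1 j) hy).2 _ (hmem.1 hj)
          (List.count_le_length.trans (by simp))
        refine h1.trans ?_
        rw [mul_assoc]
        have h2 : 1 ≤ Real.exp (-ε j) * Real.exp 1 := by
          rw [← Real.exp_add]
          exact Real.one_le_exp (by linarith [hε1 j])
        have := hε0 j
        gcongr
        simp only [hw]
        rw [← mul_assoc]
        exact le_mul_of_one_le_left (by positivity) h2
      · rw [if_neg hj]
        have h0 : (List.ofFn J).count j = 0 := by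
          rw [hmem] at hj; omega
        rw [h0, pow_zero, one_mul, mul_one]
        refine (hε j (y.1 j) hy).1.trans ?_
        have := Real.add_one_le_exp (-ε j)
        linarith
    · have : 0 ≤ (if ∃ i, J i = j then w j else 1) := by
        split_ifs
        exacts [hw0 j, zero_le_one]
      positivity
  have hpow : (Real.log d) ^ ((r : ℝ) / 2) = s ^ r := by
    rw [hs, Real.sqrt_eq_rpow, ← Real.rpow_natCast, ← Real.rpow_mul (by linarith)]
    congr 1; ring
  calc _ ≤ ∑ J : Fin r → Fin d,
        (C * s) ^ r * Real.exp (-S) * ∏ j, (if ∃ i, J i = j then w j else 1) :=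
        Finset.sum_le_sum fun J _ => hJ J
    _ = (C * s) ^ r * Real.exp (-S) *
        ∑ J : Fin r → Fin d, ∏ j, (if ∃ i, J i = j then w j else 1) := by rw [Finset.mul_sum]
    _ ≤ (C * s) ^ r * Real.exp (-S) * (Real.exp 1 ^ r * (r.factorial * Real.exp (r + 1 + S))) := by
        gcongr
        refine (sum_support_prod d w hw0 r).trans ?_
        rw [hsumw]
        have h1 : (1 : ℝ) ≤ Real.exp 1 := Real.one_le_exp (by norm_num)
        have h2 : (r : ℝ) + Real.exp 1 * (S + 1) ≤ Real.exp 1 * (r + 1 + S) := by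
          have : (0 : ℝ) ≤ r := by positivity
          nlinarith
        have h3 := Real.pow_div_factorial_le_exp (r + 1 + S) (by positivity) r
        rw [div_le_iff₀ (by positivity), mul_comm] at h3
        calc _ ≤ (Real.exp 1 * (r + 1 + S)) ^ r := by gcongr
          _ = Real.exp 1 ^ r * (r + 1 + S) ^ r := mul_pow _ _ _
          _ ≤ _ := by gcongr
    _ = _ := by
        rw [hpow, Real.exp_add _ S, mul_pow, Real.exp_neg]
        field_simp
end
end

section
/- Let μ, ν, K be probability measures on ℝ^d and let ε > 0 satisfy α := K({x : ‖x‖_∞ ≤ ε}) > 1/2. Let h : ℝ^d → ℝ be bounded and measurable. For x ∈ ℝ^d and δ > 0 put M_h(x; δ) = sup{h(y) : ‖y − x‖_∞ ≤ δ} and m_h(x; δ) = inf{h(y) : ‖y − x‖_∞ ≤ δ}; for y ∈ ℝ^d let h_y(x) = h(x + y); define γ(h; ε) = max{∫ M_h(·; ε) d(μ−ν)*K, −∫ m_h(·; ε) d(μ−ν)*K}, τ(h; 2ε) = ∫ [M_h(·; 2ε) − m_h(·; 2ε)] dν, γ*(h; ε) = sup_y γ(h_y; ε) and τ*(h; 2ε)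 = sup_y τ(h_y; 2ε), where * denotes convolution of measures. Then |∫ h d(μ − ν)| ≤ (2α − 1)^{−1} [γ*(h; ε) + τ*(h; 2ε)]. -/
open MeasureTheory Real

noncomputable section

/-- `M_h(x; δ)`: the supremum of `h` over the closed `‖·‖_∞`-ball of radius `δ` around `x`. -/
def Msup {d : ℕ} (h : (Fin d → ℝ) → ℝ) (δ : ℝ) (x : Fin d → ℝ) : ℝ :=
  ⨆ y : {y : Fin d → ℝ // ‖y - x‖ ≤ δ}, h y

/-- `m_h(x; δ)`: the infimum of `h` over the closed `‖·‖_∞`-ball of radius `δ` around `x`. -/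
def minf {d : ℕ} (h : (Fin d → ℝ) → ℝ) (δ : ℝ) (x : Fin d → ℝ) : ℝ :=
  ⨅ y : {y : Fin d → ℝ // ‖y - x‖ ≤ δ}, h y

/-- `γ(h; ε)` for the pair `(μ, ν)` smoothed by `K`. -/
def gammaSm {d : ℕ} (μ ν K : Measure (Fin d → ℝ)) (h : (Fin d → ℝ) → ℝ) (ε : ℝ) : ℝ :=
  max ((∫ x, Msup h ε x ∂(Measure.conv μ K)) - ∫ x, Msup h ε x ∂(Measure.conv ν K))
    (-((∫ x, minf h ε x ∂(Measure.conv μ K)) - ∫ x, minf h ε x ∂(Measure.conv ν K)))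

/-- `τ(h; 2ε)` with respect to `ν`. -/
def tauSm {d : ℕ} (ν : Measure (Fin d → ℝ)) (h : (Fin d → ℝ) → ℝ) (ε : ℝ) : ℝ :=
  ∫ x, (Msup h (2 * ε) x - minf h (2 * ε) x) ∂ν

section Analytic

attribute [local instance] PiNat.metricSpaceNatNat

/-- Inner regularity of a finite measure for continuous images of the Baire space. -/
theorem exists_compact_of_range {X : Type*} [TopologicalSpace X] [MeasurableSpace X]
    (μ : Measure X) [μ.OuterRegular]
    (f : (ℕ → ℕ) → X) (hf : Continuous f) (c : ENNReal) (hc : c < μ (Set.range f)) :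
    ∃ L : Set X, IsCompact L ∧ L ⊆ Set.range f ∧ c ≤ μ L := by
  have step : ∀ (k : ℕ) (S : {S : Set (ℕ → ℕ) // c < μ (f '' S)}),
      ∃ m : ℕ, c < μ (f '' (S.1 ∩ {x | x k ≤ m})) := by
    intro k S
    have hU : f '' S.1 = ⋃ m : ℕ, f '' (S.1 ∩ {x | x k ≤ m}) := by
      rw [← Set.image_iUnion, ← Set.inter_iUnion]
      congr 1
      symm
      apply Set.inter_eq_left.2
      intro x _
      exact Set.mem_iUnion.2 ⟨x k, le_refl (x k)⟩
    have hS := S.2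
    rw [hU, Monotone.measure_iUnion] at hS
    · exact lt_iSup_iff.1 hS
    · intro a b hab
      apply Set.image_mono
      rintro x ⟨h1, h2⟩
      exact ⟨h1, le_trans (h2 : x k ≤ a) hab⟩
  choose m hm using step
  let seq : ℕ → {S : Set (ℕ → ℕ) // c < μ (f '' S)} := fun k =>
    Nat.rec ⟨Set.univ, by simpa using hc⟩ (fun k S => ⟨S.1 ∩ {x | x k ≤ m k S}, hm k S⟩) k
  let n : ℕ → ℕ := fun k => m k (seq k)
  have hseq : ∀ k, (seq k).1 ⊆ {x | ∀ i < k, x i ≤ n i} := by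
    intro k
    induction k with
    | zero => intro x _ i hi; omega
    | succ k ih =>
      rintro x ⟨h1, h2⟩ i hi
      rcases Nat.lt_succ_iff_lt_or_eq.1 hi with h | h
      · exact ih h1 i h
      · subst h; exact h2
  let C : Set (ℕ → ℕ) := Set.pi Set.univ (fun i => Set.Iic (n i))
  have hC : IsCompact C := isCompact_univ_pi (fun i => (Set.finite_Iic (n i)).isCompact)
  refine ⟨f '' C, hC.image hf, Set.image_subset_range _ _, ?_⟩
  by_contra! hlt
  obtain ⟨U, hU, hUo, hUc⟩ := (f '' C).exists_isOpen_lt_of_lt c hlt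
  obtain ⟨δ, hδ, hth⟩ := hC.exists_thickening_subset_open (hUo.preimage hf)
    (Set.image_subset_iff.1 hU)
  obtain ⟨k, hk⟩ := exists_pow_lt_of_lt_one hδ (by norm_num : (1 / 2 : ℝ) < 1)
  have hsub : f '' (seq k).1 ⊆ U := by
    rw [Set.image_subset_iff]
    intro x hx
    apply hth
    rw [Metric.mem_thickening_iff]
    refine ⟨fun i => min (x i) (n i), fun i _ => Set.mem_Iic.2 (min_le_right (x i) (n i)), lt_of_le_of_lt ?_ hk⟩
    rw [← PiNat.mem_cylinder_iff_dist_le, PiNat.mem_cylinder_iff]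
    intro i hi
    exact (min_eq_left (hseq k hx i hi)).symm
  exact absurd (lt_of_lt_of_le (seq k).2 (measure_mono hsub)) (not_lt.2 hUc.le)

end Analytic

/-- Analytic sets are universally measurable. -/
theorem analyticSet_nullMeasurable {X : Type*} [TopologicalSpace X] [T2Space X]
    [MeasurableSpace X] [OpensMeasurableSpace X]
    (μ : Measure X) [IsFiniteMeasure μ] [μ.OuterRegular] {s : Set X} (hs : AnalyticSet s) :
    NullMeasurableSet s μ := by
  rw [AnalyticSet] at hs
  rcases hs with rfl | ⟨f, hf, rfl⟩
  · exact nullMeasurableSet_empty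
  by_cases h0 : μ (Set.range f) = 0
  · exact NullMeasurableSet.of_null h0
  obtain ⟨u, -, hu, hlim⟩ := exists_seq_strictMono_tendsto' (pos_iff_ne_zero.2 h0)
  choose L hL hLs hLc using fun n => exists_compact_of_range μ f hf (u n) (hu n).2
  have hB : MeasurableSet (⋃ n, L n) := MeasurableSet.iUnion fun n => (hL n).measurableSet
  have hge : μ (Set.range f) ≤ μ (⋃ n, L n) :=
    le_of_tendsto' hlim fun n => (hLc n).trans (measure_mono (Set.subset_iUnion L n))
  exact hB.nullMeasurableSet.congr
    (ae_eq_of_subset_of_measure_ge (Set.iUnion_subset hLs) hge hB.nullMeasurableSet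
      (measure_ne_top _ _))

section Aux

variable {d : ℕ}

theorem bddAbove_aux {h : (Fin d → ℝ) → ℝ} {M : ℝ} (hb : ∀ x, |h x| ≤ M) (δ : ℝ)
    (x : Fin d → ℝ) :
    BddAbove (Set.range fun y : {y : Fin d → ℝ // ‖y - x‖ ≤ δ} => h y) :=
  ⟨M, by rintro _ ⟨y, rfl⟩; exact (abs_le.1 (hb y)).2⟩

theorem le_Msup {h : (Fin d → ℝ) → ℝ} {M : ℝ} (hb : ∀ x, |h x| ≤ M) {δ : ℝ}
    {x y : Fin d → ℝ} (hy : ‖y - x‖ ≤ δ) : h y ≤ Msup h δ x :=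
  le_ciSup (bddAbove_aux hb δ x) ⟨y, hy⟩

theorem Msup_le {h : (Fin d → ℝ) → ℝ} {δ : ℝ} (hδ : 0 ≤ δ)
    {x : Fin d → ℝ} {c : ℝ} (H : ∀ y, ‖y - x‖ ≤ δ → h y ≤ c) : Msup h δ x ≤ c := by
  have : Nonempty {y : Fin d → ℝ // ‖y - x‖ ≤ δ} := ⟨⟨x, by simpa using hδ⟩⟩
  exact ciSup_le fun y => H y y.2

theorem minf_eq (h : (Fin d → ℝ) → ℝ) (δ : ℝ) (x : Fin d → ℝ) :
    minf h δ x = -Msup (fun y => -h y) δ x := by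
  unfold minf Msup
  rw [iInf, Real.sInf_def, iSup]
  congr 2
  ext r
  simp [neg_eq_iff_eq_neg]

theorem abs_Msup_le {h : (Fin d → ℝ) → ℝ} {M : ℝ} (hb : ∀ x, |h x| ≤ M) {δ : ℝ} (hδ : 0 ≤ δ)
    (x : Fin d → ℝ) : |Msup h δ x| ≤ M := by
  rw [abs_le]
  constructor
  · exact (abs_le.1 (hb x)).1.trans (le_Msup hb (by simpa using hδ))
  · exact Msup_le hδ fun y _ => (abs_le.1 (hb y)).2

theorem Msup_aem {h : (Fin d → ℝ) → ℝ} {M : ℝ} (hm : Measurable h) (hb : ∀ x, |h x| ≤ M)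
    {δ : ℝ} (hδ : 0 ≤ δ) (ρ : Measure (Fin d → ℝ)) [IsFiniteMeasure ρ] :
    AEMeasurable (Msup h δ) ρ := by
  apply NullMeasurable.aemeasurable
  have key : ∀ t : ℝ, NullMeasurableSet (Msup h δ ⁻¹' Set.Ioi t) ρ := by
    intro t
    have : Msup h δ ⁻¹' Set.Ioi t =
        (fun p : (Fin d → ℝ) × (Fin d → ℝ) => p.1 + p.2) ''
          ((h ⁻¹' Set.Ioi t) ×ˢ Metric.closedBall 0 δ) := by
      ext x
      constructor
      · intro hx
        by_contra hcon
        have hx' : t < Msup h δ x := hx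
        apply not_le.2 hx'
        apply Msup_le hδ
        intro y hy
        by_contra! hty
        refine hcon ⟨(y, x - y), ⟨hty, ?_⟩, by simp⟩
        rw [mem_closedBall_zero_iff, norm_sub_rev]
        exact hy
      · rintro ⟨⟨y, z⟩, ⟨h1, h2⟩, rfl⟩
        refine lt_of_lt_of_le (h1 : t < h y) (le_Msup hb ?_)
        simpa using h2
    rw [this]
    apply analyticSet_nullMeasurable
    apply AnalyticSet.image_of_continuous _ (by fun_prop)
    exact ((hm measurableSet_Ioi).prod Metric.isClosed_closedBall.measurableSet).analyticSet
  have : @Measurable (NullMeasurableSpace (Fin d → ℝ) ρ) ℝ _ _ (Msup h δ) :=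
    measurable_of_Ioi key
  intro s hs
  exact this hs

theorem integrable_of_aem {f : (Fin d → ℝ) → ℝ} {M : ℝ} {ρ : Measure (Fin d → ℝ)}
    [IsFiniteMeasure ρ] (hf : AEMeasurable f ρ) (hb : ∀ x, |f x| ≤ M) : Integrable f ρ :=
  Integrable.of_bound hf.aestronglyMeasurable M (Filter.Eventually.of_forall hb)

theorem tau_neg (ν : Measure (Fin d → ℝ)) (h : (Fin d → ℝ) → ℝ) (ε : ℝ) :
    tauSm ν (fun x => -h x) ε = tauSm ν h ε := by
  unfold tauSm
  congr 1
  ext x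
  rw [minf_eq, minf_eq]
  simp only [neg_neg]
  ring

theorem tau_le (ν : Measure (Fin d → ℝ)) [IsProbabilityMeasure ν] {h : (Fin d → ℝ) → ℝ} {M : ℝ}
    (hb : ∀ x, |h x| ≤ M) {ε : ℝ} (hε : 0 < ε) :
    tauSm ν h ε ≤ 2 * M := by
  unfold tauSm
  have : ∀ x, ‖Msup h (2 * ε) x - minf h (2 * ε) x‖ ≤ 2 * M := by
    intro x
    have h1 := abs_Msup_le hb (by positivity : 0 ≤ 2 * ε) x
    have h2 := abs_Msup_le (h := fun y => -h y) (M := M) (by simpa using hb)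
      (by positivity : 0 ≤ 2 * ε) x
    rw [minf_eq, Real.norm_eq_abs]
    rw [abs_le] at *
    constructor <;> linarith
  have := norm_integral_le_of_norm_le_const (μ := ν) (Filter.Eventually.of_forall this)
  simp only [probReal_univ, mul_one] at this
  exact (le_abs_self _).trans this

theorem gamma_le (μ ν K : Measure (Fin d → ℝ)) [IsProbabilityMeasure μ] [IsProbabilityMeasure ν]
    [IsProbabilityMeasure K] {h : (Fin d → ℝ) → ℝ} {M : ℝ}
    (hb : ∀ x, |h x| ≤ M) {ε : ℝ} (hε : 0 < ε) :
    gammaSm μ ν K h ε ≤ 2 * M := by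
  have bd : ∀ (ρ : Measure (Fin d → ℝ)) [IsProbabilityMeasure ρ] (f : (Fin d → ℝ) → ℝ),
      (∀ x, |f x| ≤ M) → |∫ x, f x ∂ρ| ≤ M := by
    intro ρ _ f hf
    have := norm_integral_le_of_norm_le_const (μ := ρ) (f := f) (C := M) (Filter.Eventually.of_forall hf)
    simpa using this
  have hM := abs_Msup_le hb hε.le
  have hm : ∀ x, |minf h ε x| ≤ M := by
    intro x
    rw [minf_eq, abs_neg]
    exact abs_Msup_le (h := fun y => -h y) (M := M) (by simpa using hb) hε.le x
  have a1 := abs_le.1 (bd (Measure.conv μ K) _ hM)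
  have a2 := abs_le.1 (bd (Measure.conv ν K) _ hM)
  have a3 := abs_le.1 (bd (Measure.conv μ K) _ hm)
  have a4 := abs_le.1 (bd (Measure.conv ν K) _ hm)
  unfold gammaSm
  apply max_le <;> linarith [a1.1, a1.2, a2.1, a2.2, a3.1, a3.2, a4.1, a4.2]

theorem conv_fubini (μ K : Measure (Fin d → ℝ)) [IsProbabilityMeasure μ] [IsProbabilityMeasure K]
    {g : (Fin d → ℝ) → ℝ} (hg : Integrable g (Measure.conv μ K)) :
    Integrable (fun z => ∫ x, g (z + x) ∂μ) K ∧
      ∫ x, g x ∂(Measure.conv μ K) = ∫ z, ∫ x, g (z + x) ∂μ ∂K := by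
  rw [Measure.conv_comm] at hg ⊢
  refine ⟨?_, integral_conv hg⟩
  have : Integrable (fun p : (Fin d → ℝ) × (Fin d → ℝ) => g (p.1 + p.2)) (K.prod μ) :=
    hg.comp_measurable (by fun_prop)
  exact this.integral_prod_left

theorem one_sided (μ ν K : Measure (Fin d → ℝ)) [IsProbabilityMeasure μ] [IsProbabilityMeasure ν]
    [IsProbabilityMeasure K] {h : (Fin d → ℝ) → ℝ} {M : ℝ} (hm : Measurable h)
    (hb : ∀ x, |h x| ≤ M) {ε : ℝ} (hε : 0 < ε) {α : ℝ} (hα : α = (K {x | ‖x‖ ≤ ε}).toReal)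
    {D T : ℝ} (hD : ∀ z, -D ≤ (∫ x, h (x + z) ∂μ) - ∫ x, h (x + z) ∂ν)
    (hT : ∀ z, tauSm ν (fun x => h (x + z)) ε ≤ T) :
    α * ((∫ x, h x ∂μ) - ∫ x, h x ∂ν) - (1 - α) * D - T ≤
      (∫ x, Msup h ε x ∂(Measure.conv μ K)) - ∫ x, Msup h ε x ∂(Measure.conv ν K) := by
  have hε2 : 0 ≤ 2 * ε := by positivity
  have hgb := abs_Msup_le hb hε.le
  have hgi : ∀ (ρ : Measure (Fin d → ℝ)) [IsFiniteMeasure ρ], Integrable (Msup h ε) ρ :=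
    fun ρ _ => integrable_of_aem (Msup_aem hm hb hε.le ρ) hgb
  have hgz : ∀ (ρ : Measure (Fin d → ℝ)) [IsFiniteMeasure ρ] (z : Fin d → ℝ),
      Integrable (fun x => Msup h ε (z + x)) ρ := fun ρ _ z =>
    (hgi (ρ.map (fun x => z + x))).comp_measurable (by fun_prop)
  obtain ⟨i1, e1⟩ := conv_fubini μ K (hgi (Measure.conv μ K))
  obtain ⟨i2, e2⟩ := conv_fubini ν K (hgi (Measure.conv ν K))
  rw [e1, e2, ← integral_sub i1 i2]
  have hSm : MeasurableSet {x : Fin d → ℝ | ‖x‖ ≤ ε} :=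
    measurableSet_le measurable_norm measurable_const
  set a : ℝ := (∫ x, h x ∂μ) - ∫ x, h x ∂ν with ha
  -- shifted functions
  have hzb : ∀ z x, |h (x + z)| ≤ M := fun z x => hb _
  have hzm : ∀ z, Measurable fun x => h (x + z) := fun z => hm.comp (measurable_add_const z)
  have hzi : ∀ (ρ : Measure (Fin d → ℝ)) [IsFiniteMeasure ρ] z,
      Integrable (fun x => h (x + z)) ρ :=
    fun ρ _ z => integrable_of_aem (hzm z).aemeasurable (hzb z)
  have hMz : ∀ z, Integrable (Msup (fun x => h (x + z)) (2 * ε)) ν := fun z =>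
    integrable_of_aem (Msup_aem (hzm z) (hzb z) hε2 ν) (abs_Msup_le (hzb z) hε2)
  have hnb : ∀ z x, |(fun x => -h (x + z)) x| ≤ M := fun z x => by simpa using hb _
  have hmz : ∀ z, Integrable (minf (fun x => h (x + z)) (2 * ε)) ν := fun z => by
    have : minf (fun x => h (x + z)) (2 * ε) =
        fun x => -Msup (fun y => -h (y + z)) (2 * ε) x := by
      ext x; rw [minf_eq]
    rw [this]
    exact (integrable_of_aem (Msup_aem (hzm z).neg (hnb z) hε2 ν)
      (abs_Msup_le (hnb z) hε2)).neg
  have tau_eq : ∀ z, (∫ x, Msup (fun x => h (x + z)) (2 * ε) x ∂ν)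
      - ∫ x, minf (fun x => h (x + z)) (2 * ε) x ∂ν ≤ T := by
    intro z
    rw [← integral_sub (hMz z) (hmz z)]
    exact hT z
  have minf_int : ∀ z, ∫ x, minf (fun x => h (x + z)) (2 * ε) x ∂ν ≤ ∫ x, h (x + z) ∂ν := by
    intro z
    refine integral_mono (hmz z) (hzi ν z) fun x => ?_
    rw [minf_eq]
    have := le_Msup (hnb z) (x := x) (y := x) (δ := 2 * ε) (by simpa using hε2)
    simp only at this ⊢
    linarith
  -- the two pointwise bounds
  -- general estimate: centre `w` with `z - w` small
  have pt : ∀ z w : Fin d → ℝ, ‖z - w‖ ≤ ε →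
      ((∫ x, h (x + w) ∂μ) - ∫ x, h (x + w) ∂ν) - T ≤
        (∫ x, Msup h ε (z + x) ∂μ) - ∫ x, Msup h ε (z + x) ∂ν := by
    intro z w hzw
    have l1 : ∫ x, h (x + w) ∂μ ≤ ∫ x, Msup h ε (z + x) ∂μ := by
      refine integral_mono (hzi μ w) (hgz μ z) fun x => ?_
      apply le_Msup hb
      rw [show x + w - (z + x) = -(z - w) by abel, norm_neg]
      exact hzw
    have l2 : ∫ x, Msup h ε (z + x) ∂ν ≤ ∫ x, Msup (fun x => h (x + w)) (2 * ε) x ∂ν := by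
      refine integral_mono (hgz ν z) (hMz w) fun x => ?_
      apply Msup_le hε.le
      intro y hy
      have := le_Msup (hzb w) (x := x) (y := y - w) (δ := 2 * ε) (by
        rw [show y - w - x = (y - (z + x)) + (z - w) by abel]
        exact (norm_add_le _ _).trans (by linarith))
      simpa using this
    linarith [tau_eq w, minf_int w]
  have hB : Integrable (fun z => ({x : Fin d → ℝ | ‖x‖ ≤ ε}.indicator (fun _ => a + D) z
      + (-D - T))) K :=
    ((integrable_const _).indicator hSm).add (integrable_const _)
  have hfin := integral_mono hB (i1.sub i2) (fun z => by
    simp only [Pi.sub_apply]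
    by_cases hz : ‖z‖ ≤ ε
    · rw [Set.indicator_of_mem (show z ∈ {x : Fin d → ℝ | ‖x‖ ≤ ε} from hz)]
      have := pt z 0 (by simpa using hz)
      simp only [add_zero] at this
      linarith
    · rw [Set.indicator_of_notMem (show z ∉ {x : Fin d → ℝ | ‖x‖ ≤ ε} from hz)]
      have := pt z z (by simpa using hε.le)
      linarith [hD z])
  rw [integral_add ((integrable_const _).indicator hSm) (integrable_const _),
    integral_indicator_const _ hSm] at hfin
  simp only [integral_const, probReal_univ, smul_eq_mul, one_mul, Pi.sub_apply,
    measureReal_def, ← hα] at hfin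
  refine le_trans (le_of_eq ?_) hfin
  simp
  ring

end Aux

/-- **Lemma 4 (modification of the smoothing inequality of Bhattacharya and Rao).** -/
theorem smoothing_inequality
    (d : ℕ)
    (μ ν K : Measure (Fin d → ℝ))
    (hμ : IsProbabilityMeasure μ) (hν : IsProbabilityMeasure ν)
    (hK : IsProbabilityMeasure K)
    (ε : ℝ) (hε : 0 < ε)
    (α : ℝ) (hα : α = (K {x | ‖x‖ ≤ ε}).toReal) (hα2 : 1 / 2 < α)
    (h : (Fin d → ℝ) → ℝ) (hmeas : Measurable h) (hbdd : ∃ M : ℝ, ∀ x, |h x| ≤ M) :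
    |(∫ x, h x ∂μ) - ∫ x, h x ∂ν| ≤
      (2 * α - 1)⁻¹ *
        ((⨆ y : Fin d → ℝ, gammaSm μ ν K (fun x => h (x + y)) ε) +
          ⨆ y : Fin d → ℝ, tauSm ν (fun x => h (x + y)) ε) := by
  obtain ⟨M, hb⟩ := hbdd
  set a : (Fin d → ℝ) → ℝ := fun y => (∫ x, h (x + y) ∂μ) - ∫ x, h (x + y) ∂ν with ha
  set G : ℝ := ⨆ y : Fin d → ℝ, gammaSm μ ν K (fun x => h (x + y)) ε with hG
  set T : ℝ := ⨆ y : Fin d → ℝ, tauSm ν (fun x => h (x + y)) ε with hT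
  have hzb : ∀ z x, |h (x + z)| ≤ M := fun z x => hb _
  have hzm : ∀ z, Measurable fun x => h (x + z) := fun z => hmeas.comp (measurable_add_const z)
  have hGle : ∀ y, gammaSm μ ν K (fun x => h (x + y)) ε ≤ G := fun y =>
    le_ciSup (f := fun y => gammaSm μ ν K (fun x => h (x + y)) ε)
      ⟨2 * M, by rintro _ ⟨y, rfl⟩; exact gamma_le μ ν K (hzb y) hε⟩ y
  have hTle : ∀ y, tauSm ν (fun x => h (x + y)) ε ≤ T := fun y =>
    le_ciSup (f := fun y => tauSm ν (fun x => h (x + y)) ε)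
      ⟨2 * M, by rintro _ ⟨y, rfl⟩; exact tau_le ν (hzb y) hε⟩ y
  have hbd : ∀ (ρ : Measure (Fin d → ℝ)) [IsProbabilityMeasure ρ] (y : Fin d → ℝ),
      |∫ x, h (x + y) ∂ρ| ≤ M := by
    intro ρ _ y
    have := norm_integral_le_of_norm_le_const (μ := ρ) (f := fun x => h (x + y)) (C := M)
      (Filter.Eventually.of_forall (hzb y))
    simpa using this
  have hab : ∀ y, |a y| ≤ 2 * M := fun y =>
    (abs_sub _ _).trans (by linarith [hbd μ y, hbd ν y])
  set D : ℝ := ⨆ y, |a y| with hDdef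
  have hDle : ∀ y, |a y| ≤ D := fun y =>
    le_ciSup (f := fun y => |a y|) ⟨2 * M, by rintro _ ⟨y, rfl⟩; exact hab y⟩ y
  have hkey : ∀ y, α * |a y| ≤ G + T + (1 - α) * D := by
    intro y
    have hp := one_sided μ ν K (hzm y) (hzb y) hε hα (D := D) (T := T)
      (fun z => by
        have := (abs_le.1 (hDle (z + y))).1
        simpa only [ha, add_assoc] using this)
      (fun z => by
        have := hTle (z + y)
        simpa only [add_assoc] using this)
    have hn := one_sided μ ν K (h := fun x => -h (x + y)) (M := M) (hzm y).neg
      (by simpa using hzb y) hε hα (D := D) (T := T)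
      (fun z => by
        have := (abs_le.1 (hDle (z + y))).2
        simp only [integral_neg, add_assoc]
        simp only [ha] at this
        linarith)
      (fun z => by
        have := hTle (z + y)
        rw [tau_neg ν (fun x => h (x + z + y))]
        simpa only [add_assoc] using this)
    have hg := hGle y
    unfold gammaSm at hg
    obtain ⟨g1, g2⟩ := max_le_iff.1 hg
    simp only [minf_eq, integral_neg] at g2
    simp only [integral_neg] at hn
    rcases abs_cases (a y) with ⟨e, -⟩ | ⟨e, -⟩ <;> rw [e] <;> simp only [ha] <;> linarith
  have hαpos : 0 < α := by linarith
  have hDfin : D ≤ (G + T + (1 - α) * D) / α :=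
    ciSup_le fun y => by
      rw [le_div_iff₀ hαpos]
      linarith [hkey y]
  rw [le_div_iff₀ hαpos] at hDfin
  have h0 : |(∫ x, h x ∂μ) - ∫ x, h x ∂ν| ≤ D := by
    have := hDle 0
    simpa [ha] using this
  refine h0.trans ?_
  rw [inv_mul_eq_div, le_div_iff₀ (by linarith)]
  linarith
end
end

section
/- Let φ₁ denote the standard normal density on ℝ and, for an integer ν ≥ 1, let H_ν be the ν-th (probabilists') Hermite polynomial, h_ν(u) = H_{ν−1}(u) φ₁(u), u_ν the maximum real root of H_ν, M_ν = max_{0≤u≤u_ν} |H_{ν−1}(u)|, and define h̃_ν : [0,∞) → (0,∞) by h̃_ν(u) = M_ν φ₁(u) for 0 ≤ u ≤ u_ν and h̃_ν(u) = h_ν(u) for u > u_ν. Then h̃_ν is decreasing on [0,∞) and |h_ν(u)| ≤ h̃_ν(|u|) for all u ∈ ℝ. -/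
open MeasureTheory Real Polynomial

noncomputable section

/-- The standard normal density on `ℝ`. -/
def gaussD (u : ℝ) : ℝ := (Real.sqrt (2 * π))⁻¹ * Real.exp (-u ^ 2 / 2)

/-- The `ν`-th (probabilists') Hermite polynomial, evaluated at a real number. -/
def hermiteR (ν : ℕ) (u : ℝ) : ℝ := Polynomial.aeval u (Polynomial.hermite ν)

theorem hermiteR_succ (n : ℕ) (u : ℝ) : hermiteR (n + 1) u =
    u * hermiteR n u - aeval u (derivative (hermite n)) := by
  simp [hermiteR, hermite_succ]

theorem hasDerivAt_h (n : ℕ) (u : ℝ) :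
    HasDerivAt (fun u => hermiteR n u * gaussD u) (-(hermiteR (n + 1) u * gaussD u)) u := by
  have h1 : HasDerivAt (fun u => hermiteR n u) (aeval u (derivative (hermite n))) u :=
    Polynomial.hasDerivAt_aeval (hermite n) u
  have h2 : HasDerivAt gaussD (-u * gaussD u) u := by
    have h3 : HasDerivAt (fun u : ℝ => -u ^ 2 / 2) (-u) u := by
      have := ((hasDerivAt_pow 2 u).neg).div_const 2
      exact this.congr_deriv (by simp; ring)
    have := (h3.exp).const_mul (Real.sqrt (2 * π))⁻¹
    exact this.congr_deriv (by simp only [gaussD]; ring)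
  exact (h1.mul h2).congr_deriv (by rw [hermiteR_succ]; ring)

theorem hermite_comp_neg (n : ℕ) : (hermite n).comp (-X) = (-1) ^ n * hermite n := by
  induction n with
  | zero => simp
  | succ n ih =>
    have h := congrArg derivative ih
    have h4 : derivative ((-1 : ℤ[X]) ^ n) = 0 := by
      have : ((-1 : ℤ[X]) ^ n) = C ((-1) ^ n) := by simp
      rw [this, derivative_C]
    rw [derivative_comp, derivative_mul, h4] at h
    simp only [derivative_neg, derivative_X] at h
    rw [hermite_succ, sub_comp, mul_comp, X_comp, ih, pow_succ]
    linear_combination h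

theorem abs_hermiteR_abs (n : ℕ) (u : ℝ) : |hermiteR n (|u|)| = |hermiteR n u| := by
  have key : |hermiteR n (-u)| = |hermiteR n u| := by
    have h := congrArg (aeval u) (hermite_comp_neg n)
    rw [aeval_comp] at h
    simp only [map_neg, aeval_X, map_mul, map_pow, map_one] at h
    simp only [hermiteR]
    rw [h, abs_mul]
    simp
  rcases abs_choice u with h | h <;> rw [h]
  exact key

theorem hermiteR_eventually_pos (n : ℕ) : ∀ᶠ u in Filter.atTop, 0 < hermiteR n u := by
  rcases Nat.eq_zero_or_pos n with rfl | hn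
  · simp [hermiteR]
  · have hm := (hermite_monic n).map (algebraMap ℤ ℝ)
    have := Polynomial.tendsto_atTop_of_leadingCoeff_nonneg ((hermite n).map (algebraMap ℤ ℝ))
      (by rw [(hermite_monic n).degree_map, degree_hermite]; exact_mod_cast hn)
      (by rw [hm.leadingCoeff]; norm_num)
    filter_upwards [this.eventually_gt_atTop 0] with u hu
    simpa [hermiteR, aeval_def, eval_map] using hu

theorem gaussD_pos (u : ℝ) : 0 < gaussD u := by
  unfold gaussD; positivity

theorem gaussD_anti {x y : ℝ} (hx : 0 ≤ x) (hxy : x ≤ y) : gaussD y ≤ gaussD x := by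
  unfold gaussD
  gcongr

theorem hermiteR_continuous (n : ℕ) : Continuous (hermiteR n) :=
  Polynomial.continuous_aeval (hermite n)

theorem hermiteR_pos_of_gt (n : ℕ) (a : ℝ) (ha : ∀ u, hermiteR n u = 0 → u ≤ a)
    (u : ℝ) (hu : a < u) : 0 < hermiteR n u := by
  by_contra! hc
  obtain ⟨v, hv, huv⟩ := ((hermiteR_eventually_pos n).and (Filter.eventually_ge_atTop u)).exists
  obtain ⟨w, hw, hw0⟩ := intermediate_value_Icc huv (hermiteR_continuous n).continuousOn
    (show (0 : ℝ) ∈ Set.Icc _ _ from ⟨hc, hv.le⟩)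
  linarith [ha w hw0, hw.1]

/-- **Lemma 5: the majorant `h̃_ν` is decreasing on `[0,∞)` and dominates `|h_ν|`.** -/
theorem htilde_antitone_and_dominates
    (ν : ℕ) (hν : 1 ≤ ν)
    (uν : ℝ) (huν : IsGreatest {u : ℝ | hermiteR ν u = 0} uν)
    (Mν : ℝ) (hMν : IsGreatest ((fun u => |hermiteR (ν - 1) u|) '' Set.Icc 0 uν) Mν)
    (htilde : ℝ → ℝ)
    (hht : htilde = fun u => if u ≤ uν then Mν * gaussD u else hermiteR (ν - 1) u * gaussD u) :
    AntitoneOn htilde (Set.Ici 0) ∧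
      ∀ u : ℝ, |hermiteR (ν - 1) u * gaussD u| ≤ htilde |u| := by
  obtain ⟨n, rfl⟩ : ∃ n, ν = n + 1 := ⟨ν - 1, by omega⟩
  simp only [Nat.add_sub_cancel] at *
  have hpos := hermiteR_pos_of_gt (n + 1) uν (fun u hu => huν.2 hu)
  have hanti : AntitoneOn (fun u => hermiteR n u * gaussD u) (Set.Ici uν) := by
    apply antitoneOn_of_deriv_nonpos (convex_Ici uν)
    · exact fun u _ => (hasDerivAt_h n u).continuousAt.continuousWithinAt
    · exact fun u _ => (hasDerivAt_h n u).differentiableAt.differentiableWithinAt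
    · intro u hu
      rw [interior_Ici] at hu
      rw [(hasDerivAt_h n u).deriv]
      have := mul_pos (hpos u hu) (gaussD_pos u)
      linarith
  have hnonneg : ∀ u, uν ≤ u → 0 ≤ hermiteR n u * gaussD u := by
    intro u hu
    obtain ⟨v, hv, huv⟩ :=
      ((hermiteR_eventually_pos n).and (Filter.eventually_ge_atTop u)).exists
    have h1 := hanti (Set.mem_Ici.2 hu) (Set.mem_Ici.2 (hu.trans huv)) huv
    exact (mul_pos hv (gaussD_pos v)).le.trans h1
  have hM : ∀ u, 0 ≤ u → u ≤ uν → |hermiteR n u| ≤ Mν :=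
    fun u h0 h1 => hMν.2 ⟨u, ⟨h0, h1⟩, rfl⟩
  obtain ⟨⟨w, ⟨hw0, hw1⟩, hw⟩, -⟩ := hMν
  have hM0 : 0 ≤ Mν := (abs_nonneg _).trans (hM w hw0 hw1)
  have hu0 : 0 ≤ uν := hw0.trans hw1
  subst hht
  constructor
  · intro x hx y hy hxy
    have hx0 : 0 ≤ x := hx
    dsimp only
    split_ifs with h1 h2 h2
    · exact mul_le_mul_of_nonneg_left (gaussD_anti hx0 hxy) hM0
    · linarith
    · have h3 := hanti (Set.mem_Ici.2 le_rfl) (Set.mem_Ici.2 (not_le.1 h1).le) (not_le.1 h1).le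
      refine h3.trans ?_
      exact mul_le_mul ((le_abs_self _).trans (hM uν hu0 le_rfl)) (gaussD_anti hx0 h2)
        (gaussD_pos _).le hM0
    · exact hanti (Set.mem_Ici.2 (not_le.1 h2).le) (Set.mem_Ici.2 (not_le.1 h1).le) hxy
  · intro u
    have hg : gaussD |u| = gaussD u := by simp [gaussD]
    have he : |hermiteR n u * gaussD u| = |hermiteR n (|u|) * gaussD (|u|)| := by
      rw [abs_mul, abs_mul, abs_hermiteR_abs, hg]
    rw [he]
    dsimp only
    split_ifs with h
    · rw [abs_mul, abs_of_pos (gaussD_pos _)]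
      exact mul_le_mul_of_nonneg_right (hM _ (abs_nonneg u) h) (gaussD_pos _).le
    · rw [abs_of_nonneg (hnonneg _ (not_le.1 h).le)]
end
end

section
/- Let φ₁ and Φ₁ denote the standard normal density and distribution function on ℝ. There is an absolute constant C > 0 such that for every d ≥ 3: sup_{x∈ℝ^d} ∑_{j=1}^d φ₁(x_j) ∏_{k≠j} Φ₁(x_k) ≤ C √(log d). -/
open MeasureTheory Real

noncomputable section

/-- The standard normal distribution function on `ℝ`. -/
def gaussCdf (u : ℝ) : ℝ := ∫ t in Set.Iic u, gaussD t

lemma gaussD_eq : gaussD = ProbabilityTheory.gaussianPDFReal 0 1 := by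
  funext u
  simp [gaussD, ProbabilityTheory.gaussianPDFReal]

lemma gaussD_nonneg (u : ℝ) : 0 ≤ gaussD u := by
  unfold gaussD; positivity

lemma gaussD_integrable : Integrable gaussD := by
  rw [gaussD_eq]; exact ProbabilityTheory.integrable_gaussianPDFReal 0 1

lemma gaussCdf_nonneg (u : ℝ) : 0 ≤ gaussCdf u :=
  setIntegral_nonneg measurableSet_Iic (fun t _ => gaussD_nonneg t)

lemma one_sub_gaussCdf (u : ℝ) : 1 - gaussCdf u = ∫ t in Set.Ioi u, gaussD t := by
  have h1 : ∫ t, gaussD t = 1 := by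
    rw [gaussD_eq]; exact ProbabilityTheory.integral_gaussianPDFReal_eq_one 0 (by norm_num)
  have h2 := integral_add_compl (measurableSet_Iic (a := u)) gaussD_integrable
  rw [Set.compl_Iic, h1] at h2
  unfold gaussCdf
  linarith

lemma gaussCdf_le_one (u : ℝ) : gaussCdf u ≤ 1 := by
  have h := one_sub_gaussCdf u
  have h2 : 0 ≤ ∫ t in Set.Ioi u, gaussD t :=
    setIntegral_nonneg measurableSet_Ioi (fun t _ => gaussD_nonneg t)
  linarith

lemma gaussD_anti_s16 {u v : ℝ} (h : u ^ 2 ≤ v ^ 2) : gaussD v ≤ gaussD u := by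
  unfold gaussD
  gcongr

/-- Lower bound of Mills type. -/
lemma gaussD_le_tail {M x : ℝ} (hM : 1 ≤ M) (hx : x ≤ M) :
    gaussD x ≤ Real.exp (3 / 2) * M * (1 - gaussCdf x) := by
  have hM0 : 0 < M := by linarith
  set y := max x 0 with hy
  have hy0 : 0 ≤ y := le_max_right _ _
  have hxy : x ≤ y := le_max_left _ _
  have hyM : y ≤ M := max_le hx hM0.le
  have hD : gaussD x ≤ gaussD y := by
    apply gaussD_anti_s16
    rcases le_total x 0 with h | h
    · rw [hy, max_eq_right h]; nlinarith [sq_nonneg x]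
    · rw [hy, max_eq_left h]
  have hM1 : M⁻¹ ≤ 1 := inv_le_one_of_one_le₀ hM
  have hMi : 0 < M⁻¹ := inv_pos.mpr hM0
  have hsh : gaussD y ≤ Real.exp (3 / 2) * gaussD (y + M⁻¹) := by
    unfold gaussD
    rw [mul_left_comm, ← Real.exp_add]
    gcongr
    have h1 : y * M⁻¹ ≤ 1 := by
      rw [← div_eq_mul_inv, div_le_one hM0]; exact hyM
    nlinarith
  have hint : M⁻¹ * gaussD (y + M⁻¹) ≤ 1 - gaussCdf x := by
    rw [one_sub_gaussCdf]
    calc M⁻¹ * gaussD (y + M⁻¹) = ∫ t in Set.Ioc y (y + M⁻¹), gaussD (y + M⁻¹) := by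
          simp [hMi.le]
      _ ≤ ∫ t in Set.Ioc y (y + M⁻¹), gaussD t := by
          apply setIntegral_mono_on _ gaussD_integrable.integrableOn measurableSet_Ioc
          · intro t ht
            apply gaussD_anti_s16
            have := ht.1
            have := ht.2
            gcongr
            linarith
          · simp
      _ ≤ ∫ t in Set.Ioi x, gaussD t := by
          apply setIntegral_mono_set gaussD_integrable.integrableOn
          · exact Filter.Eventually.of_forall gaussD_nonneg
          · apply Filter.Eventually.of_forall
            intro t ht
            exact lt_of_le_of_lt hxy ht.1
  calc gaussD x ≤ Real.exp (3 / 2) * gaussD (y + M⁻¹) := hD.trans hsh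
    _ = Real.exp (3 / 2) * M * (M⁻¹ * gaussD (y + M⁻¹)) := by field_simp
    _ ≤ _ := by gcongr

/-- The probability of exactly one or no success is at most one. -/
lemma sum_mul_prod_le {ι : Type*} [DecidableEq ι] (p : ι → ℝ) (h0 : ∀ i, 0 ≤ p i)
    (h1 : ∀ i, p i ≤ 1) (s : Finset ι) :
    ∑ j ∈ s, (1 - p j) * ∏ k ∈ s.erase j, p k + ∏ k ∈ s, p k ≤ 1 := by
  induction s using Finset.induction_on with
  | empty => simp
  | insert a s ha ih =>
    rw [Finset.sum_insert ha, Finset.prod_insert ha, Finset.erase_insert ha]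
    have e : ∑ j ∈ s, (1 - p j) * ∏ k ∈ (insert a s).erase j, p k
        = p a * ∑ j ∈ s, (1 - p j) * ∏ k ∈ s.erase j, p k := by
      rw [Finset.mul_sum]
      apply Finset.sum_congr rfl
      intro j hj
      have hne : a ≠ j := fun h => ha (h ▸ hj)
      rw [Finset.erase_insert_of_ne hne,
        Finset.prod_insert (fun h => ha (Finset.mem_of_mem_erase h))]
      ring
    rw [e]
    have hP : ∏ k ∈ s, p k ≤ 1 := Finset.prod_le_one (fun i _ => h0 i) (fun i _ => h1 i)
    nlinarith [h0 a, h1 a, mul_le_mul_of_nonneg_left ih (h0 a),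
      mul_le_mul_of_nonneg_left hP (sub_nonneg.mpr (h1 a))]

/-- **Lemma 8: the Anderson–Hall–Titterington-type estimate for first derivatives.** -/
theorem sum_density_prod_cdf_le :
    ∃ C : ℝ, 0 < C ∧
      ∀ (d : ℕ), 3 ≤ d →
      ∀ x : Fin d → ℝ,
        ∑ j, gaussD (x j) * ∏ k ∈ Finset.univ.erase j, gaussCdf (x k) ≤
          C * Real.sqrt (Real.log d) := by
  refine ⟨1 + Real.exp (3 / 2) * Real.sqrt 2, by positivity, ?_⟩
  intro d hd x
  have hd3 : (3 : ℝ) ≤ d := by exact_mod_cast hd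
  have hd0 : (0 : ℝ) < d := by linarith
  have hlog : 1 ≤ Real.log d := by
    rw [Real.le_log_iff_exp_le hd0]
    linarith [Real.exp_one_lt_d9]
  have hs1 : 1 ≤ Real.sqrt (Real.log d) := Real.one_le_sqrt.mpr hlog
  set M := Real.sqrt 2 * Real.sqrt (Real.log d) with hMdef
  have hM2 : M ^ 2 = 2 * Real.log d := by
    rw [hMdef, mul_pow, Real.sq_sqrt (by norm_num), Real.sq_sqrt (by linarith)]
  have hM0 : 0 ≤ M := by positivity
  have hM : 1 ≤ M := by nlinarith
  have key : ∀ j, gaussD (x j) * ∏ k ∈ Finset.univ.erase j, gaussCdf (x k) ≤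
      1 / d + Real.exp (3 / 2) * M *
        ((1 - gaussCdf (x j)) * ∏ k ∈ Finset.univ.erase j, gaussCdf (x k)) := by
    intro j
    have hP0 : 0 ≤ ∏ k ∈ Finset.univ.erase j, gaussCdf (x k) :=
      Finset.prod_nonneg (fun i _ => gaussCdf_nonneg _)
    have hP1 : ∏ k ∈ Finset.univ.erase j, gaussCdf (x k) ≤ 1 :=
      Finset.prod_le_one (fun i _ => gaussCdf_nonneg _) (fun i _ => gaussCdf_le_one _)
    have hq : 0 ≤ 1 - gaussCdf (x j) := sub_nonneg.mpr (gaussCdf_le_one _)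
    rcases le_total (x j) M with h | h
    · have h1 := mul_le_mul_of_nonneg_right (gaussD_le_tail hM h) hP0
      have h2 : 0 ≤ 1 / (d : ℝ) := by positivity
      linarith
    · have h1 : gaussD (x j) ≤ 1 / d := by
        refine (gaussD_anti_s16 (u := M) (by gcongr)).trans ?_
        unfold gaussD
        have e : -M ^ 2 / 2 = - Real.log d := by rw [hM2]; ring
        rw [e, Real.exp_neg, Real.exp_log hd0, one_div]
        apply mul_le_of_le_one_left (by positivity)
        apply inv_le_one_of_one_le₀
        rw [Real.one_le_sqrt]
        linarith [Real.pi_gt_three]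
      have h2 := mul_le_of_le_one_right (gaussD_nonneg (x j)) hP1
      have h3 : 0 ≤ Real.exp (3 / 2) * M *
        ((1 - gaussCdf (x j)) * ∏ k ∈ Finset.univ.erase j, gaussCdf (x k)) := by positivity
      linarith
  have hsum := Finset.sum_le_sum (fun j (_ : j ∈ Finset.univ) => key j)
  rw [Finset.sum_add_distrib, ← Finset.mul_sum] at hsum
  have hone : ∑ _j : Fin d, 1 / (d : ℝ) = 1 := by
    simp [hd0.ne']
  rw [hone] at hsum
  have hp := sum_mul_prod_le (fun k => gaussCdf (x k)) (fun _ => gaussCdf_nonneg _)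
    (fun _ => gaussCdf_le_one _) Finset.univ
  have hPn : 0 ≤ ∏ k, gaussCdf (x k) := Finset.prod_nonneg (fun i _ => gaussCdf_nonneg _)
  have hS : ∑ j, (1 - gaussCdf (x j)) * ∏ k ∈ Finset.univ.erase j, gaussCdf (x k) ≤ 1 := by
    linarith
  have h4 := mul_le_mul_of_nonneg_left hS (by positivity : 0 ≤ Real.exp (3 / 2) * M)
  have h5 : Real.exp (3 / 2) * M = Real.exp (3 / 2) * Real.sqrt 2 * Real.sqrt (Real.log d) := by
    rw [hMdef]; ring
  linarith
end
end
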